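/- Let d ≥ d' ≥ 1, let dμ be the normalized Haar probability measure on O(d), and let r > 0. For every integrable function f on ℝ^d one has (∫_{|y|≤r} |f(y)| dy) / (∫_{|y|≤r} dy) = (∫_{O(d)} ∫_{|y_{d'}|≤r} |f(θ(y_{d'},0))| |y_{d'}|^{d−d'} dy_{d'} dμ(θ)) / (∫_{|y_{d'}|≤r} |y_{d'}|^{d−d'} dy_{d'}). -/

import Mathlib

open MeasureTheory Metric
open scoped ENNReal

noncomputable section

instance matrixMeasurableSpace {d : ℕ} : MeasurableSpace (Matrix (Fin d) (Fin d) ℝ) :=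
  borel _

instance matrixBorelSpace {d : ℕ} : BorelSpace (Matrix (Fin d) (Fin d) ℝ) :=
  ⟨rfl⟩

/-- The centered Hardy-Littlewood maximal operator on `ℝ^d`. -/
def maximalHL {d : ℕ} (f : EuclideanSpace ℝ (Fin d) → ℝ) (x : EuclideanSpace ℝ (Fin d)) : ℝ :=
  ⨆ (r : ℝ) (_ : 0 < r), ⨍ y in ball x r, |f y|

/-- A matrix acts on `ℝ^d` (with the Euclidean structure) by `x ↦ Ax`. -/
def matAct {d : ℕ} (A : Matrix (Fin d) (Fin d) ℝ) (x : EuclideanSpace ℝ (Fin d)) :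
    EuclideanSpace ℝ (Fin d) :=
  (EuclideanSpace.equiv (Fin d) ℝ).symm (A.mulVec (EuclideanSpace.equiv (Fin d) ℝ x))

/-- Embedding `ℝ^{d'} → ℝ^d = ℝ^{d'} × ℝ^{d-d'}`, `y ↦ (y,0)`. -/
def emb {d d' : ℕ} (h : d' ≤ d) (y : EuclideanSpace ℝ (Fin d')) :
    EuclideanSpace ℝ (Fin d) :=
  (EuclideanSpace.equiv (Fin d) ℝ).symm
    (fun i => if h' : (i : ℕ) < d' then y ⟨i, h'⟩ else 0)

open Module in
/-- Polar coordinates for the lower Lebesgue integral of a radial function. -/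
lemma lintegral_fun_norm_addHaar {E : Type*} [NormedAddCommGroup E] [NormedSpace ℝ E]
    [Nontrivial E] [MeasurableSpace E] [BorelSpace E] [FiniteDimensional ℝ E]
    (μ : Measure E) [μ.IsAddHaarMeasure] {f : ℝ → ℝ≥0∞} (hf : Measurable f) :
    ∫⁻ x, f ‖x‖ ∂μ = μ.toSphere Set.univ *
      ∫⁻ t in Set.Ioi (0 : ℝ), ENNReal.ofReal (t ^ (finrank ℝ E - 1)) * f t := by
  calc
    ∫⁻ x, f ‖x‖ ∂μ = ∫⁻ x : ({(0)}ᶜ : Set E), f ‖x.1‖ ∂(μ.comap (↑)) := by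
      rw [lintegral_subtype_comap (measurableSet_singleton _).compl fun x ↦ f ‖x‖,
        restrict_compl_singleton]
    _ = ∫⁻ x, f x.2 ∂μ.toSphere.prod (.volumeIoiPow (finrank ℝ E - 1)) := by
      simpa using μ.measurePreserving_homeomorphUnitSphereProd.lintegral_comp_emb
        (Homeomorph.measurableEmbedding _) (fun p ↦ f p.2)
    _ = μ.toSphere Set.univ *
        ∫⁻ t : Set.Ioi (0 : ℝ), f t ∂.volumeIoiPow (finrank ℝ E - 1) := by
      rw [lintegral_prod _ (by fun_prop)]
      simp only [lintegral_const, mul_comm]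
    _ = _ := by
      rw [Measure.volumeIoiPow, lintegral_withDensity_eq_lintegral_mul _ (by fun_prop)
        (by fun_prop), ← lintegral_subtype_comap measurableSet_Ioi]
      rfl

lemma matAct_apply {d : ℕ} (A : Matrix (Fin d) (Fin d) ℝ) (x : EuclideanSpace ℝ (Fin d))
    (i : Fin d) : matAct A x i = ∑ j, A i j * x j := rfl

lemma matAct_mul {d : ℕ} (A B : Matrix (Fin d) (Fin d) ℝ) (x : EuclideanSpace ℝ (Fin d)) :
    matAct (A * B) x = matAct A (matAct B x) :=
  (congrArg (EuclideanSpace.equiv (Fin d) ℝ).symm (Matrix.mulVec_mulVec _ A B)).symm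

lemma norm_matAct {d : ℕ} (θ : Matrix.orthogonalGroup (Fin d) ℝ)
    (x : EuclideanSpace ℝ (Fin d)) : ‖matAct (θ : Matrix (Fin d) (Fin d) ℝ) x‖ = ‖x‖ := by
  have hθ : (θ : Matrix (Fin d) (Fin d) ℝ).transpose * (θ : Matrix (Fin d) (Fin d) ℝ) = 1 :=
    (Matrix.mem_orthogonalGroup_iff' _ _).1 θ.2
  have key : ∀ v : EuclideanSpace ℝ (Fin d), ‖v‖ ^ 2 = v.ofLp ⬝ᵥ v.ofLp := fun v ↦ by
    rw [EuclideanSpace.real_norm_sq_eq]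
    simp only [dotProduct, sq]
  rw [← sq_eq_sq₀ (norm_nonneg _) (norm_nonneg _), key, key]
  change ((θ : Matrix (Fin d) (Fin d) ℝ).mulVec x.ofLp) ⬝ᵥ
    ((θ : Matrix (Fin d) (Fin d) ℝ).mulVec x.ofLp) = _
  rw [Matrix.dotProduct_mulVec, ← Matrix.mulVec_transpose, Matrix.mulVec_mulVec, hθ,
    Matrix.one_mulVec]

/-- The action of an orthogonal matrix as a linear isometry equivalence. -/
def orthogonalIsometry {d : ℕ} (θ : Matrix.orthogonalGroup (Fin d) ℝ) :
    EuclideanSpace ℝ (Fin d) ≃ₗᵢ[ℝ] EuclideanSpace ℝ (Fin d) :=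
  LinearIsometry.toLinearIsometryEquiv
    { toFun := matAct (θ : Matrix (Fin d) (Fin d) ℝ)
      map_add' := fun x y ↦ by simp [matAct, Matrix.mulVec_add]
      map_smul' := fun c x ↦ by simp [matAct, Matrix.mulVec_smul]
      norm_map' := norm_matAct θ } rfl

lemma measurePreserving_matAct {d : ℕ} (θ : Matrix.orthogonalGroup (Fin d) ℝ) :
    MeasurePreserving (matAct (θ : Matrix (Fin d) (Fin d) ℝ)) :=
  (orthogonalIsometry θ).measurePreserving

lemma exists_orthogonal_matAct_eq {d : ℕ} {x y : EuclideanSpace ℝ (Fin d)} (hxy : ‖x‖ = ‖y‖) :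
    ∃ θ : Matrix.orthogonalGroup (Fin d) ℝ, matAct (θ : Matrix (Fin d) (Fin d) ℝ) x = y := by
  set R := Submodule.reflection (Submodule.span ℝ {x - y})ᗮ
  set b := EuclideanSpace.basisFun (Fin d) ℝ
  refine ⟨⟨_, R.toMatrix_mem_unitaryGroup b b⟩, ?_⟩
  have hR : R x = y := Submodule.reflection_sub hxy
  have h := LinearMap.toMatrix_mulVec_repr b.toBasis b.toBasis R.toLinearEquiv.toLinearMap x
  ext i
  rw [← hR]
  exact congrFun h i

lemma measurable_matAct_comp {d : ℕ} {α : Type*} [MeasurableSpace α]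
    {A : α → Matrix (Fin d) (Fin d) ℝ} {x : α → EuclideanSpace ℝ (Fin d)}
    (hA : Measurable A) (hx : Measurable x) : Measurable fun a ↦ matAct (A a) (x a) := by
  have hentry : ∀ i j, Measurable fun M : Matrix (Fin d) (Fin d) ℝ ↦ M i j := fun i j ↦
    (continuous_id.matrix_elem i j).measurable
  refine (WithLp.measurable_toLp 2 _).comp (measurable_pi_lambda _ fun i ↦ ?_)
  change Measurable fun a ↦ matAct (A a) (x a) i
  simp only [matAct_apply]
  refine Finset.measurable_sum _ fun j _ ↦ ((hentry i j).comp hA).mul ?_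
  exact (measurable_pi_apply j).comp ((WithLp.measurable_ofLp 2 _).comp hx)

lemma measurable_emb {d d' : ℕ} (h : d' ≤ d) : Measurable (emb h) := by
  refine (WithLp.measurable_toLp 2 _).comp (measurable_pi_lambda _ fun i ↦ ?_)
  change Measurable fun y : EuclideanSpace ℝ (Fin d') ↦
    if h' : (i : ℕ) < d' then y ⟨i, h'⟩ else 0
  split_ifs with h'
  · exact (measurable_pi_apply _).comp (WithLp.measurable_ofLp 2 _)
  · exact measurable_const

lemma norm_emb {d d' : ℕ} (h : d' ≤ d) (y : EuclideanSpace ℝ (Fin d')) : ‖emb h y‖ = ‖y‖ := by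
  rw [← sq_eq_sq₀ (norm_nonneg _) (norm_nonneg _), EuclideanSpace.real_norm_sq_eq,
    EuclideanSpace.real_norm_sq_eq]
  obtain ⟨k, rfl⟩ := Nat.exists_eq_add_of_le h
  simp [emb, Fin.sum_univ_add]

/-- A left-invariant probability measure on the orthogonal group has rotation-invariant orbital
integrals. -/
lemma lintegral_matAct_matAct {d : ℕ} (μ : Measure (Matrix.orthogonalGroup (Fin d) ℝ))
    [IsProbabilityMeasure μ]
    (hinv : ∀ g : Matrix.orthogonalGroup (Fin d) ℝ, μ.map (fun θ => g * θ) = μ)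
    {g : EuclideanSpace ℝ (Fin d) → ℝ≥0∞} (hg : Measurable g)
    (η : Matrix.orthogonalGroup (Fin d) ℝ) (x : EuclideanSpace ℝ (Fin d)) :
    ∫⁻ θ, g (matAct (θ : Matrix (Fin d) (Fin d) ℝ)
      (matAct (η : Matrix (Fin d) (Fin d) ℝ) x)) ∂μ =
    ∫⁻ θ, g (matAct (θ : Matrix (Fin d) (Fin d) ℝ) x) ∂μ := by
  have hstar : Measurable fun θ : Matrix.orthogonalGroup (Fin d) ℝ ↦
      ((θ⁻¹ : Matrix.orthogonalGroup (Fin d) ℝ) : Matrix (Fin d) (Fin d) ℝ) :=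
    (continuous_star.comp continuous_subtype_val).measurable
  have hleft : ∀ σ : Matrix.orthogonalGroup (Fin d) ℝ,
      Measurable fun θ : Matrix.orthogonalGroup (Fin d) ℝ ↦ σ * θ := fun σ ↦
    Measurable.subtype_mk (Continuous.measurable (by fun_prop))
  -- The orbital integrals of `μ` coincide with those of its image under inversion.
  have hinvol : ∀ z : EuclideanSpace ℝ (Fin d),
      ∫⁻ θ, g (matAct (θ : Matrix (Fin d) (Fin d) ℝ) z) ∂μ =
      ∫⁻ σ, g (matAct ((σ⁻¹ : Matrix.orthogonalGroup (Fin d) ℝ) :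
        Matrix (Fin d) (Fin d) ℝ) z) ∂μ := by
    intro z
    have h1 : ∀ σ : Matrix.orthogonalGroup (Fin d) ℝ,
        ∫⁻ θ, g (matAct (σ⁻¹ * θ : Matrix.orthogonalGroup (Fin d) ℝ).1 z) ∂μ =
        ∫⁻ θ, g (matAct (θ : Matrix (Fin d) (Fin d) ℝ) z) ∂μ := fun σ ↦ by
      conv_rhs => rw [← hinv σ⁻¹]
      rw [lintegral_map (hg.fun_comp (measurable_matAct_comp measurable_subtype_coe
        measurable_const)) (hleft _)]
    have h2 : ∀ θ : Matrix.orthogonalGroup (Fin d) ℝ,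
        ∫⁻ σ, g (matAct (σ⁻¹ * θ : Matrix.orthogonalGroup (Fin d) ℝ).1 z) ∂μ =
        ∫⁻ σ, g (matAct (σ⁻¹ : Matrix.orthogonalGroup (Fin d) ℝ).1 z) ∂μ := fun θ ↦ by
      conv_rhs => rw [← hinv θ⁻¹]
      rw [lintegral_map (hg.fun_comp (measurable_matAct_comp hstar measurable_const)) (hleft _)]
      simp
    have hswap := lintegral_lintegral_swap (μ := μ) (ν := μ)
      (f := fun σ θ ↦ g (matAct (σ⁻¹ * θ : Matrix.orthogonalGroup (Fin d) ℝ).1 z)) (by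
        refine (hg.comp ?_).aemeasurable
        change Measurable fun p : Matrix.orthogonalGroup (Fin d) ℝ ×
          Matrix.orthogonalGroup (Fin d) ℝ ↦
            matAct (((p.1⁻¹ : Matrix.orthogonalGroup (Fin d) ℝ) : Matrix (Fin d) (Fin d) ℝ) *
              (p.2 : Matrix (Fin d) (Fin d) ℝ)) z
        simp only [matAct_mul]
        exact measurable_matAct_comp (hstar.comp measurable_fst)
          (measurable_matAct_comp (measurable_subtype_coe.comp measurable_snd)
            measurable_const))
    simpa only [h1, h2, lintegral_const, measure_univ, mul_one] using hswap
  rw [hinvol, hinvol]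
  conv_rhs => rw [← hinv η⁻¹]
  rw [lintegral_map (hg.fun_comp (measurable_matAct_comp hstar measurable_const)) (hleft _)]
  simp [matAct_mul]

/-- The measure `|y|^(d-d') dy` on `ℝ^{d'}`, spread out by random rotations, is a multiple of
Lebesgue measure on `ℝ^d`. -/
lemma map_matAct_emb_prod_withDensity {d d' : ℕ} (hd' : 1 ≤ d') (h : d' ≤ d)
    (μ : Measure (Matrix.orthogonalGroup (Fin d) ℝ)) [IsProbabilityMeasure μ]
    (hinv : ∀ g : Matrix.orthogonalGroup (Fin d) ℝ, μ.map (fun θ => g * θ) = μ) :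
    ∃ c : ℝ≥0∞, c ≠ 0 ∧ c ≠ ∞ ∧
      (μ.prod ((volume : Measure (EuclideanSpace ℝ (Fin d'))).withDensity
        fun y ↦ ENNReal.ofReal (‖y‖ ^ (d - d')))).map
        (fun p ↦ matAct (p.1 : Matrix (Fin d) (Fin d) ℝ) (emb h p.2)) = c • volume := by
  have : NeZero d := ⟨by omega⟩
  have : NeZero d' := ⟨by omega⟩
  set S := (volume : Measure (EuclideanSpace ℝ (Fin d))).toSphere Set.univ
  set S' := (volume : Measure (EuclideanSpace ℝ (Fin d'))).toSphere Set.univ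
  have hS : S ≠ 0 := Measure.measure_univ_ne_zero.2 (Measure.toSphere_ne_zero _)
  have hS' : S' ≠ 0 := Measure.measure_univ_ne_zero.2 (Measure.toSphere_ne_zero _)
  have hSt : S ≠ ∞ := measure_ne_top _ _
  have hSt' : S' ≠ ∞ := measure_ne_top _ _
  refine ⟨S' / S, (ENNReal.div_pos hS' hSt).ne', (ENNReal.div_lt_top hSt' hS).ne, ?_⟩
  have hT : Measurable fun p : Matrix.orthogonalGroup (Fin d) ℝ × EuclideanSpace ℝ (Fin d') ↦
      matAct (p.1 : Matrix (Fin d) (Fin d) ℝ) (emb h p.2) :=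
    measurable_matAct_comp (measurable_subtype_coe.comp measurable_fst)
      ((measurable_emb h).comp measurable_snd)
  refine Measure.ext_of_lintegral _ fun g hg ↦ ?_
  set φ : ℝ → ℝ≥0∞ := fun t ↦ ∫⁻ θ, g (matAct (θ : Matrix (Fin d) (Fin d) ℝ)
    (t • EuclideanSpace.single 0 (1 : ℝ))) ∂μ
  have hφ : Measurable φ := by
    refine Measurable.lintegral_prod_right' (f := fun p : ℝ × Matrix.orthogonalGroup (Fin d) ℝ ↦
      g (matAct (p.2 : Matrix (Fin d) (Fin d) ℝ) (p.1 • EuclideanSpace.single 0 (1 : ℝ)))) ?_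
    exact hg.fun_comp (measurable_matAct_comp (measurable_subtype_coe.comp measurable_snd)
      (by fun_prop))
  have hrad : ∀ x, ∫⁻ θ, g (matAct (θ : Matrix (Fin d) (Fin d) ℝ) x) ∂μ = φ ‖x‖ := by
    intro x
    obtain ⟨η, hη⟩ := exists_orthogonal_matAct_eq (d := d)
      (x := ‖x‖ • EuclideanSpace.single 0 (1 : ℝ)) (y := x) (by simp [norm_smul])
    conv_lhs => rw [← hη]
    exact lintegral_matAct_matAct μ hinv hg η _
  set J := ∫⁻ t in Set.Ioi (0 : ℝ), ENNReal.ofReal (t ^ (d - 1)) * φ t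
  have hvol : ∫⁻ x, g x = S * J := by
    calc ∫⁻ x, g x = ∫⁻ _ : Matrix.orthogonalGroup (Fin d) ℝ, ∫⁻ x, g x ∂volume ∂μ := by simp
      _ = ∫⁻ θ : Matrix.orthogonalGroup (Fin d) ℝ,
            ∫⁻ x, g (matAct (θ : Matrix (Fin d) (Fin d) ℝ) x) ∂volume ∂μ := by
          refine lintegral_congr fun θ ↦ ?_
          rw [(measurePreserving_matAct θ).lintegral_comp hg]
      _ = ∫⁻ x : EuclideanSpace ℝ (Fin d), φ ‖x‖ := by
          rw [lintegral_lintegral_swap]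
          · simp only [hrad]
          · exact (hg.fun_comp (measurable_matAct_comp (measurable_subtype_coe.comp measurable_fst)
              measurable_snd)).aemeasurable
      _ = S * J := by
          simpa only [finrank_euclideanSpace, Fintype.card_fin] using lintegral_fun_norm_addHaar
            (volume : Measure (EuclideanSpace ℝ (Fin d))) hφ
  rw [lintegral_map hg hT, lintegral_prod_symm _ (hg.fun_comp hT).aemeasurable]
  simp only [hrad, norm_emb]
  rw [lintegral_withDensity_eq_lintegral_mul _ (by fun_prop) (by fun_prop)]
  have hpolar := lintegral_fun_norm_addHaar (volume : Measure (EuclideanSpace ℝ (Fin d')))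
    (f := fun t ↦ ENNReal.ofReal (t ^ (d - d')) * φ t) (by fun_prop)
  simp only [Pi.mul_apply]
  rw [hpolar, lintegral_smul_measure, hvol, smul_eq_mul, ← mul_assoc,
    ENNReal.div_mul_cancel hS hSt]
  congr 1
  refine setLIntegral_congr_fun measurableSet_Ioi fun t ht ↦ ?_
  have ht0 : (0 : ℝ) ≤ t := le_of_lt ht
  simp only [finrank_euclideanSpace, Fintype.card_fin]
  rw [← mul_assoc, ← ENNReal.ofReal_mul (by positivity), ← pow_add]
  congr 4
  omega


/-- **Integration over the orthogonal group recovers ball averages** (identity (4.2)). -/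
theorem ball_average_eq_integral_orthogonal (d d' : ℕ) (hd' : 1 ≤ d') (h : d' ≤ d)
    (μ : Measure (Matrix.orthogonalGroup (Fin d) ℝ)) [IsProbabilityMeasure μ]
    (hinv : ∀ g : Matrix.orthogonalGroup (Fin d) ℝ, μ.map (fun θ => g * θ) = μ)
    (f : EuclideanSpace ℝ (Fin d) → ℝ) (hf : Integrable f volume) (r : ℝ) (hr : 0 < r) :
    (∫ y in closedBall (0 : EuclideanSpace ℝ (Fin d)) r, |f y|) /
        (∫ y in closedBall (0 : EuclideanSpace ℝ (Fin d)) r, (1 : ℝ)) =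
      (∫ θ : Matrix.orthogonalGroup (Fin d) ℝ,
          ∫ y in closedBall (0 : EuclideanSpace ℝ (Fin d')) r,
            |f (matAct (θ : Matrix (Fin d) (Fin d) ℝ) (emb h y))| * ‖y‖ ^ (d - d') ∂volume ∂μ) /
        (∫ y in closedBall (0 : EuclideanSpace ℝ (Fin d')) r, ‖y‖ ^ (d - d')) := by
  obtain ⟨c, hc0, hct, hmap⟩ := map_matAct_emb_prod_withDensity hd' h μ hinv
  set ν := (volume : Measure (EuclideanSpace ℝ (Fin d'))).withDensity
    fun y ↦ ENNReal.ofReal (‖y‖ ^ (d - d')) with hν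
  have hT : Measurable fun p : Matrix.orthogonalGroup (Fin d) ℝ × EuclideanSpace ℝ (Fin d') ↦
      matAct (p.1 : Matrix (Fin d) (Fin d) ℝ) (emb h p.2) :=
    measurable_matAct_comp (measurable_subtype_coe.comp measurable_fst)
      ((measurable_emb h).comp measurable_snd)
  have key : ∀ u : EuclideanSpace ℝ (Fin d) → ℝ,
      IntegrableOn u (closedBall (0 : EuclideanSpace ℝ (Fin d)) r) →
      ∫ θ : Matrix.orthogonalGroup (Fin d) ℝ,
          ∫ y in closedBall (0 : EuclideanSpace ℝ (Fin d')) r,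
            u (matAct (θ : Matrix (Fin d) (Fin d) ℝ) (emb h y)) * ‖y‖ ^ (d - d') ∂volume ∂μ =
        c.toReal * ∫ y in closedBall (0 : EuclideanSpace ℝ (Fin d)) r, u y := by
    intro u hu
    set v := (closedBall (0 : EuclideanSpace ℝ (Fin d)) r).indicator u with hv
    have hvi : Integrable v (c • volume) :=
      ((integrable_indicator_iff measurableSet_closedBall).2 hu).smul_measure hct
    rw [← integral_indicator measurableSet_closedBall, ← smul_eq_mul c.toReal,
      ← integral_smul_measure, ← hv]
    rw [← hmap] at hvi ⊢
    rw [integral_map hT.aemeasurable hvi.1,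
      integral_prod (fun p : Matrix.orthogonalGroup (Fin d) ℝ × EuclideanSpace ℝ (Fin d') ↦
        v (matAct (p.1 : Matrix (Fin d) (Fin d) ℝ) (emb h p.2))) (hvi.comp_measurable hT)]
    refine integral_congr_ae (.of_forall fun θ ↦ ?_)
    simp only
    rw [hν, integral_withDensity_eq_integral_toReal_smul (by fun_prop) (by simp),
      ← integral_indicator measurableSet_closedBall]
    refine integral_congr_ae (.of_forall fun y ↦ ?_)
    by_cases hy : ‖y‖ ≤ r <;> simp [hv, Set.indicator, norm_matAct, norm_emb, hy, mul_comm]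
  have hone := key (fun _ ↦ 1) (integrableOn_const (measure_closedBall_lt_top).ne)
  simp only [one_mul, integral_const, probReal_univ, one_smul] at hone
  rw [key (fun y ↦ |f y|) hf.abs.integrableOn, hone]
  have hc : c.toReal ≠ 0 := (ENNReal.toReal_pos hc0 hct).ne'
  simp only [integral_const]
  rw [mul_div_mul_left _ _ hc]
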